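/- arXiv:q-alg/9606018 — 2 statements merged into one kernel-verified Lean document; each statement's English description precedes it below -/
import Mathlib

section
/- Let Y₁, Y₂ ∈ 𝒟 with Y₁Y₂ ≠ 0 and Y₂Y₁ ≠ 0. Then for every positive integer ρ, the following are equivalent: (i) every nonzero Q ∈ 𝒟 commuting with Y₁Y₂ has order divisible by ρ; (ii) every nonzero Q ∈ 𝒟 commuting with Y₂Y₁ has order divisible by ρ. Consequently Y₁Y₂ and Y₂Y₁ have the same true rank, where the true rank of a differential operator X is the greatest common divisor of the orders of the nonzero elements of its centralizer in 𝒟. -/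
open scoped BigOperators

/-- The derivation `∂`, regarded as a `ℂ`-linear endomorphism of `ℂ(x)`. -/
noncomputable def delOp (D : Derivation ℂ (RatFunc ℂ) (RatFunc ℂ)) :
    Module.End ℂ (RatFunc ℂ) :=
  D.toLinearMap

/-- Multiplication by a rational function, as a `ℂ`-linear endomorphism of `ℂ(x)`. -/
noncomputable def mulOp (h : RatFunc ℂ) : Module.End ℂ (RatFunc ℂ) :=
  LinearMap.mulLeft ℂ h

/-- The ring `𝒟` of ordinary differential operators with rational function
coefficients: the subalgebra of `End_ℂ(ℂ(x))` generated by `∂` and all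
multiplication operators. -/
noncomputable def Dalg (D : Derivation ℂ (RatFunc ℂ) (RatFunc ℂ)) :
    Subalgebra ℂ (Module.End ℂ (RatFunc ℂ)) :=
  Algebra.adjoin ℂ ({delOp D} ∪ Set.range mulOp)

/-- `T` can be written as `∑_{k ≤ d} M_{h_k} ∘ ∂^k`. -/
def hasOrdAtMost (D : Derivation ℂ (RatFunc ℂ) (RatFunc ℂ))
    (T : Module.End ℂ (RatFunc ℂ)) (d : ℕ) : Prop :=
  ∃ h : ℕ → RatFunc ℂ, T = ∑ k ∈ Finset.range (d + 1), mulOp (h k) * delOp D ^ k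

/-- The order of an ordinary differential operator: the least `d` such that
`T = ∑_{k ≤ d} M_{h_k} ∘ ∂^k`. -/
noncomputable def ordOf (D : Derivation ℂ (RatFunc ℂ) (RatFunc ℂ))
    (T : Module.End ℂ (RatFunc ℂ)) : ℕ :=
  sInf {d | hasOrdAtMost D T d}

open Polynomial in
/-- The operator `∑ M_{h_k} ∘ ∂^k` attached to the polynomial `∑ h_k X^k`. -/
noncomputable def opOfPoly (D : Derivation ℂ (RatFunc ℂ) (RatFunc ℂ)) (P : (RatFunc ℂ)[X]) :
    Module.End ℂ (RatFunc ℂ) :=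
  P.sum fun k h => mulOp h * delOp D ^ k

section

open Polynomial

variable (D : Derivation ℂ (RatFunc ℂ) (RatFunc ℂ))

theorem mulOp_apply (h f : RatFunc ℂ) : mulOp h f = h * f := rfl

theorem mulOp_zero : mulOp 0 = 0 := by ext; simp [mulOp_apply]

theorem mulOp_one : mulOp 1 = 1 := by ext; simp [mulOp_apply]

theorem mulOp_add (a b : RatFunc ℂ) : mulOp (a + b) = mulOp a + mulOp b := by
  ext; simp [mulOp_apply, add_mul]

theorem mulOp_mul (a b : RatFunc ℂ) : mulOp (a * b) = mulOp a * mulOp b := by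
  ext; simp [mulOp_apply, mul_assoc]

theorem delOp_mul_mulOp (h : RatFunc ℂ) :
    delOp D * mulOp h = mulOp h * delOp D + mulOp (D h) := by
  ext f
  simp [mulOp_apply, delOp, mul_comm]

theorem opOfPoly_monomial (k : ℕ) (h : RatFunc ℂ) :
    opOfPoly D (monomial k h) = mulOp h * delOp D ^ k :=
  sum_monomial_index _ _ (by simp [mulOp_zero])

theorem opOfPoly_zero : opOfPoly D 0 = 0 := sum_zero_index _

theorem opOfPoly_add (P Q : (RatFunc ℂ)[X]) :
    opOfPoly D (P + Q) = opOfPoly D P + opOfPoly D Q :=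
  sum_add_index _ _ _ (by simp [mulOp_zero]) (by simp [mulOp_add, add_mul])

theorem opOfPoly_C_mul (h : RatFunc ℂ) (P : (RatFunc ℂ)[X]) :
    opOfPoly D (C h * P) = mulOp h * opOfPoly D P := by
  induction P using Polynomial.induction_on' with
  | add P Q hP hQ => simp only [mul_add, opOfPoly_add, hP, hQ]
  | monomial k a => simp only [C_mul_monomial, opOfPoly_monomial, mulOp_mul, mul_assoc]

theorem exists_opOfPoly_eq_delOp_mul (P : (RatFunc ℂ)[X]) :
    ∃ R : (RatFunc ℂ)[X], opOfPoly D R = delOp D * opOfPoly D P ∧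
      ∀ n, R.coeff n = (P * X).coeff n + D (P.coeff n) := by
  induction P using Polynomial.induction_on' with
  | add P Q hP hQ =>
    obtain ⟨R, hR, hR'⟩ := hP
    obtain ⟨S, hS, hS'⟩ := hQ
    refine ⟨R + S, by rw [opOfPoly_add, opOfPoly_add, hR, hS, mul_add], fun n => ?_⟩
    rw [coeff_add, hR', hS', add_mul, coeff_add, coeff_add, map_add, add_add_add_comm]
  | monomial k a =>
    refine ⟨monomial k a * X + monomial k (D a), ?_, fun n => ?_⟩
    · rw [opOfPoly_add, monomial_mul_X]
      simp only [opOfPoly_monomial, ← mul_assoc, delOp_mul_mulOp, add_mul, pow_succ']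
    · rw [coeff_add, coeff_monomial, coeff_monomial, apply_ite D, map_zero]

theorem exists_opOfPoly_eq_delOp_pow_mul (Q : (RatFunc ℂ)[X]) {q : ℕ} (hQ : Q.natDegree ≤ q)
    (k : ℕ) : ∃ R : (RatFunc ℂ)[X], opOfPoly D R = delOp D ^ k * opOfPoly D Q ∧
      R.natDegree ≤ k + q ∧ R.coeff (k + q) = Q.coeff q := by
  induction k with
  | zero => exact ⟨Q, by simp, by simpa using hQ, by simp⟩
  | succ k ih =>
    obtain ⟨R, hR, hdeg, hcoeff⟩ := ih
    obtain ⟨S, hS, hS'⟩ := exists_opOfPoly_eq_delOp_mul D R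
    refine ⟨S, by rw [hS, hR, pow_succ', mul_assoc], ?_, ?_⟩
    · rw [natDegree_le_iff_coeff_eq_zero]
      intro n hn
      obtain ⟨m, rfl⟩ : ∃ m, n = m + 1 := ⟨n - 1, by omega⟩
      rw [hS', coeff_mul_X, coeff_eq_zero_of_natDegree_lt (by omega : R.natDegree < m),
        coeff_eq_zero_of_natDegree_lt (by omega : R.natDegree < m + 1), map_zero, add_zero]
    · rw [add_right_comm, hS', coeff_mul_X, hcoeff,
        coeff_eq_zero_of_natDegree_lt (by omega : R.natDegree < k + q + 1), map_zero, add_zero]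

theorem exists_opOfPoly_eq_mul (P Q : (RatFunc ℂ)[X]) {p q : ℕ} (hP : P.natDegree ≤ p)
    (hQ : Q.natDegree ≤ q) : ∃ R : (RatFunc ℂ)[X], opOfPoly D R = opOfPoly D P * opOfPoly D Q ∧
      R.natDegree ≤ p + q ∧ R.coeff (p + q) = P.coeff p * Q.coeff q := by
  refine Polynomial.induction_with_natDegree_le (fun P => ∃ R : (RatFunc ℂ)[X],
    opOfPoly D R = opOfPoly D P * opOfPoly D Q ∧
      R.natDegree ≤ p + q ∧ R.coeff (p + q) = P.coeff p * Q.coeff q) p ?_ ?_ ?_ P hP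
  · exact ⟨0, by simp [opOfPoly_zero]⟩
  · intro k a _ hk
    obtain ⟨R, hR, hdeg, hcoeff⟩ := exists_opOfPoly_eq_delOp_pow_mul D Q hQ k
    refine ⟨C a * R, ?_, ?_, ?_⟩
    · rw [opOfPoly_C_mul, hR, C_mul_X_pow_eq_monomial, opOfPoly_monomial, mul_assoc]
    · exact (natDegree_C_mul_le a R).trans (by omega)
    · rcases hk.eq_or_lt with rfl | hlt
      · simp [hcoeff]
      · rw [coeff_C_mul, coeff_C_mul_X_pow, if_neg hlt.ne', zero_mul,
          coeff_eq_zero_of_natDegree_lt (by omega), mul_zero]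
  · rintro P₁ P₂ _ _ ⟨R₁, e₁, d₁, c₁⟩ ⟨R₂, e₂, d₂, c₂⟩
    exact ⟨R₁ + R₂, by rw [opOfPoly_add, opOfPoly_add, e₁, e₂, add_mul],
      natDegree_add_le_of_degree_le d₁ d₂, by rw [coeff_add, coeff_add, c₁, c₂, add_mul]⟩

theorem exists_opOfPoly_eq {T : Module.End ℂ (RatFunc ℂ)} (hT : T ∈ Dalg D) :
    ∃ P : (RatFunc ℂ)[X], opOfPoly D P = T := by
  induction hT using Algebra.adjoin_induction with
  | mem T hT =>
    rcases hT with rfl | ⟨h, rfl⟩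
    · exact ⟨monomial 1 1, by simp [opOfPoly_monomial, mulOp_one]⟩
    · exact ⟨monomial 0 h, by rw [opOfPoly_monomial, pow_zero, mul_one]⟩
  | algebraMap c =>
    refine ⟨monomial 0 (algebraMap ℂ (RatFunc ℂ) c), ?_⟩
    rw [opOfPoly_monomial, pow_zero, mul_one]
    ext f
    rw [mulOp_apply, Module.algebraMap_end_apply, Algebra.smul_def]
  | add S T _ _ hS hT =>
    obtain ⟨P, rfl⟩ := hS
    obtain ⟨Q, rfl⟩ := hT
    exact ⟨P + Q, opOfPoly_add D P Q⟩
  | mul S T _ _ hS hT =>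
    obtain ⟨P, rfl⟩ := hS
    obtain ⟨Q, rfl⟩ := hT
    obtain ⟨R, hR, -⟩ := exists_opOfPoly_eq_mul D P Q le_rfl le_rfl
    exact ⟨R, hR⟩

theorem hasOrdAtMost_iff {T : Module.End ℂ (RatFunc ℂ)} {d : ℕ} :
    hasOrdAtMost D T d ↔ ∃ P : (RatFunc ℂ)[X], P.natDegree ≤ d ∧ opOfPoly D P = T := by
  constructor
  · rintro ⟨h, rfl⟩
    refine ⟨∑ k ∈ Finset.range (d + 1), monomial k (h k), ?_, ?_⟩
    · refine natDegree_sum_le_of_forall_le _ _ fun k hk => (natDegree_monomial_le _).trans ?_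
      exact Nat.lt_succ_iff.mp (Finset.mem_range.mp hk)
    · induction Finset.range (d + 1) using Finset.induction_on with
      | empty => simp [opOfPoly_zero]
      | insert a s ha ih =>
        rw [Finset.sum_insert ha, Finset.sum_insert ha, opOfPoly_add, ih, opOfPoly_monomial]
  · rintro ⟨P, hP, rfl⟩
    exact ⟨P.coeff, sum_over_range' P (by simp [mulOp_zero]) _ (Nat.lt_succ_of_le hP)⟩

variable {D}

theorem delOp_pow_algebraMap
    (hD : ∀ p : ℂ[X], D (algebraMap ℂ[X] (RatFunc ℂ) p)
      = algebraMap ℂ[X] (RatFunc ℂ) (derivative p))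
    (k : ℕ) (p : ℂ[X]) :
    (delOp D ^ k) (algebraMap ℂ[X] (RatFunc ℂ) p)
      = algebraMap ℂ[X] (RatFunc ℂ) (derivative^[k] p) := by
  induction k with
  | zero => simp
  | succ k ih =>
    rw [pow_succ', Module.End.mul_apply, ih, Function.iterate_succ_apply']
    exact hD _

theorem eq_zero_of_opOfPoly_eq_zero
    (hD : ∀ p : ℂ[X], D (algebraMap ℂ[X] (RatFunc ℂ) p)
      = algebraMap ℂ[X] (RatFunc ℂ) (derivative p))
    {P : (RatFunc ℂ)[X]} (hP : opOfPoly D P = 0) : P = 0 := by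
  ext n
  induction n using Nat.strong_induction_on with
  | _ n ih =>
    have key := LinearMap.congr_fun hP (algebraMap ℂ[X] (RatFunc ℂ) (X ^ n))
    rw [opOfPoly, Polynomial.sum_def, LinearMap.sum_apply, Finset.sum_eq_single n] at key
    · rw [Module.End.mul_apply, delOp_pow_algebraMap hD, iterate_derivative_X_pow_eq_C_mul,
        mulOp_apply] at key
      simpa [Nat.factorial_ne_zero] using key
    · intro k _ hk
      rw [Module.End.mul_apply, delOp_pow_algebraMap hD, mulOp_apply]
      rcases hk.lt_or_gt with hlt | hgt
      · rw [ih k hlt, coeff_zero, zero_mul]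
      · rw [iterate_derivative_eq_zero (by simpa using hgt), map_zero, mul_zero]
    · intro hn
      rw [notMem_support_iff.mp hn, mulOp_zero, zero_mul, LinearMap.zero_apply]

theorem opOfPoly_injective
    (hD : ∀ p : ℂ[X], D (algebraMap ℂ[X] (RatFunc ℂ) p)
      = algebraMap ℂ[X] (RatFunc ℂ) (derivative p)) :
    Function.Injective (opOfPoly D) := by
  intro P Q h
  have hsub : opOfPoly D (P - Q) = 0 := by
    have hadd := opOfPoly_add D (P - Q) Q
    rwa [sub_add_cancel, h, right_eq_add] at hadd
  exact sub_eq_zero.mp (eq_zero_of_opOfPoly_eq_zero hD hsub)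

theorem ordOf_opOfPoly
    (hD : ∀ p : ℂ[X], D (algebraMap ℂ[X] (RatFunc ℂ) p)
      = algebraMap ℂ[X] (RatFunc ℂ) (derivative p))
    (P : (RatFunc ℂ)[X]) : ordOf D (opOfPoly D P) = P.natDegree := by
  have h : {d | hasOrdAtMost D (opOfPoly D P) d} = Set.Ici P.natDegree := by
    ext d
    simp [hasOrdAtMost_iff, (opOfPoly_injective hD).eq_iff]
  rw [ordOf, h, csInf_Ici]

theorem mul_ne_zero_and_ordOf_mul
    (hD : ∀ p : ℂ[X], D (algebraMap ℂ[X] (RatFunc ℂ) p)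
      = algebraMap ℂ[X] (RatFunc ℂ) (derivative p))
    {S T : Module.End ℂ (RatFunc ℂ)} (hS : S ∈ Dalg D)
    (hT : T ∈ Dalg D) (hS0 : S ≠ 0) (hT0 : T ≠ 0) :
    S * T ≠ 0 ∧ ordOf D (S * T) = ordOf D S + ordOf D T := by
  obtain ⟨P, rfl⟩ := exists_opOfPoly_eq D hS
  obtain ⟨Q, rfl⟩ := exists_opOfPoly_eq D hT
  have hP : P ≠ 0 := fun h => hS0 (h ▸ opOfPoly_zero D)
  have hQ : Q ≠ 0 := fun h => hT0 (h ▸ opOfPoly_zero D)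
  obtain ⟨R, hR, hdeg, hcoeff⟩ := exists_opOfPoly_eq_mul D P Q le_rfl le_rfl
  have hne : R.coeff (P.natDegree + Q.natDegree) ≠ 0 := by
    rw [hcoeff]
    exact mul_ne_zero (leadingCoeff_ne_zero.mpr hP) (leadingCoeff_ne_zero.mpr hQ)
  rw [← hR]
  refine ⟨fun h => hne ?_, ?_⟩
  · rw [eq_zero_of_opOfPoly_eq_zero hD h, coeff_zero]
  · simp only [ordOf_opOfPoly hD]
    exact natDegree_eq_of_le_of_coeff_ne_zero hdeg hne

theorem dvd_ordOf_of_commute_mul_swap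
    (hD : ∀ p : ℂ[X], D (algebraMap ℂ[X] (RatFunc ℂ) p)
      = algebraMap ℂ[X] (RatFunc ℂ) (derivative p))
    {Y₁ Y₂ : Module.End ℂ (RatFunc ℂ)} (hY₁ : Y₁ ∈ Dalg D)
    (hY₂ : Y₂ ∈ Dalg D) (h12 : Y₁ * Y₂ ≠ 0) {ρ : ℕ}
    (h : ∀ Q ∈ Dalg D, Q ≠ 0 → Q * (Y₁ * Y₂) = (Y₁ * Y₂) * Q → ρ ∣ ordOf D Q) :
    ∀ Q ∈ Dalg D, Q ≠ 0 → Q * (Y₂ * Y₁) = (Y₂ * Y₁) * Q → ρ ∣ ordOf D Q := by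
  intro Q hQ hQ0 hcomm
  have h1 : Y₁ ≠ 0 := left_ne_zero_of_mul h12
  have h2 : Y₂ ≠ 0 := right_ne_zero_of_mul h12
  obtain ⟨hYQ0, hYQ⟩ := mul_ne_zero_and_ordOf_mul hD hY₁ hQ h1 hQ0
  obtain ⟨hYQY0, hYQY⟩ := mul_ne_zero_and_ordOf_mul hD (mul_mem hY₁ hQ) hY₂ hYQ0 h2
  have hd := h _ (mul_mem hY₁ hY₂) h12 rfl
  have hd' := h _ (mul_mem (mul_mem hY₁ hQ) hY₂) hYQY0 <| by
    calc Y₁ * Q * Y₂ * (Y₁ * Y₂) = Y₁ * (Q * (Y₂ * Y₁)) * Y₂ := by simp only [mul_assoc]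
      _ = Y₁ * Y₂ * (Y₁ * Q * Y₂) := by rw [hcomm]; simp only [mul_assoc]
  rw [(mul_ne_zero_and_ordOf_mul hD hY₁ hY₂ h1 h2).2] at hd
  rw [hYQY, hYQ, add_right_comm] at hd'
  exact (Nat.dvd_add_right hd).mp hd'

end

theorem statement17 (D : Derivation ℂ (RatFunc ℂ) (RatFunc ℂ))
    (hD : ∀ p : Polynomial ℂ,
      D (algebraMap (Polynomial ℂ) (RatFunc ℂ) p)
        = algebraMap (Polynomial ℂ) (RatFunc ℂ) (Polynomial.derivative p))
    (Y₁ Y₂ : Module.End ℂ (RatFunc ℂ)) (hY₁ : Y₁ ∈ Dalg D) (hY₂ : Y₂ ∈ Dalg D)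
    (h12 : Y₁ * Y₂ ≠ 0) (h21 : Y₂ * Y₁ ≠ 0) :
    ∀ ρ : ℕ, 0 < ρ →
      ((∀ Q ∈ Dalg D, Q ≠ 0 → Q * (Y₁ * Y₂) = (Y₁ * Y₂) * Q → ρ ∣ ordOf D Q) ↔
       (∀ Q ∈ Dalg D, Q ≠ 0 → Q * (Y₂ * Y₁) = (Y₂ * Y₁) * Q → ρ ∣ ordOf D Q)) := by
  intro ρ _
  exact ⟨dvd_ordOf_of_commute_mul_swap hD hY₁ hY₂ h12,
    dvd_ordOf_of_commute_mul_swap hD hY₂ hY₁ h21⟩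
end

section
/- Let λ_1, …, λ_n be complex numbers, let p_1, …, p_n be nonzero polynomials, and set φ_i(x) := p_i(x)·e^{λ_i x}; assume φ_1, …, φ_n are linearly independent over ℂ. Define the operator K̄ on entire functions by (K̄u)(x) := e^{−x·Σ_i λ_i}·det Wr(φ_1, …, φ_n, u)(x). Then: (1) K̄ has polynomial coefficients, i.e., there are polynomials c_0, …, c_n ∈ ℂ[x] with (K̄u)(x) = Σ_{k=0}^n c_k(x)·u^{(k)}(x) for all entire u and all x; (2) there exists a nonconstant polynomial p ∈ ℂ[z] such that the operator p(d/dx) maps the span of φ_1, …, φ_n into itself (so the ring R_{K̄,∂} is nontrivial); and (3) setting ψ(x,z) := e^{−x·Σ_i λ_i}·det Wr(φ_1, …, φ_n, e_z)(x), where e_z(t) := e^{tz}, there exist a nonconstant polynomial s ∈ ℂ[x], an integer d ≥ 1 and rational functions c_0, …, c_d ∈ ℂ(z) with c_d ≠ 0 such that Σ_{k=0}^d c_k(z)·∂_z^k ψ(x,z) = s(x)·ψ(x,z) for all x ∈ ℂ and all z outside the poles of the c_k (so the ring R_{♭K̄,∂} is also nontrivial and the corresponding ring of Darboux-transformed operators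 is bispectral). -/
open scoped BigOperators

/-- The Wronskian determinant of an `m`-tuple of functions. -/
noncomputable def wrDet (m : ℕ) (g : Fin m → ℂ → ℂ) (x : ℂ) : ℂ :=
  Matrix.det (Matrix.of fun k s : Fin m => iteratedDeriv k.val (g s) x)

/-- The bordered Wronskian determinant `det Wr(g₁, …, g_m, u)`. -/
noncomputable def wrDetB (m : ℕ) (g : Fin m → ℂ → ℂ) (u : ℂ → ℂ) (x : ℂ) : ℂ :=
  wrDet (m + 1) (Fin.snoc g u) x

/-- The family `φ_i(x) = p_i(x)·e^{λ_i x}`. -/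
noncomputable def phiExp (n : ℕ) (p : ℕ → Polynomial ℂ) (lam : ℕ → ℂ) :
    Fin n → ℂ → ℂ :=
  fun i x => (p i.val).eval x * Complex.exp (lam i.val * x)

/-- The operator `K̄u = e^{-x·∑λ_i}·det Wr(φ_1, …, φ_n, u)`. -/
noncomputable def kbarOne (n : ℕ) (p : ℕ → Polynomial ℂ) (lam : ℕ → ℂ)
    (u : ℂ → ℂ) (x : ℂ) : ℂ :=
  Complex.exp (-x * ∑ i ∈ Finset.range n, lam i) * wrDetB n (phiExp n p lam) u x

theorem differentiable_iteratedDeriv {f : ℂ → ℂ} (hf : Differentiable ℂ f) (k : ℕ) :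
    Differentiable ℂ (iteratedDeriv k f) :=
  (hf.contDiff (n := ⊤)).differentiable_iteratedDeriv k (by exact_mod_cast WithTop.coe_lt_top _)

theorem differentiable_det {m : ℕ} {A : ℂ → Matrix (Fin m) (Fin m) ℂ}
    (hA : ∀ i j, Differentiable ℂ fun x => A x i j) : Differentiable ℂ fun x => (A x).det := by
  simp only [Matrix.det_apply]
  fun_prop

/-- If the relations `∑ₛ aₛ(x) gₛ⁽ᵏ⁾(x) = f⁽ᵏ⁾(x)`, `k ≤ m`, hold on an open set where the
Wronskian of the `gₛ` does not vanish, then the coefficients have zero derivative there. -/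
theorem deriv_eq_zero_of_wronskian_relation {m : ℕ} {g : Fin m → ℂ → ℂ} {f : ℂ → ℂ}
    (hg : ∀ i, Differentiable ℂ (g i)) (hf : Differentiable ℂ f) {a : Fin m → ℂ → ℂ} {U : Set ℂ}
    (hU : IsOpen U) (ha : ∀ s, DifferentiableOn ℂ (a s) U) (hW : ∀ x ∈ U, wrDet m g x ≠ 0)
    (hrel : ∀ x ∈ U, ∀ k ≤ m, ∑ s, a s x * iteratedDeriv k (g s) x = iteratedDeriv k f x)
    {x : ℂ} (hx : x ∈ U) (s : Fin m) : deriv (a s) x = 0 := by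
  have key : ∀ k < m, ∑ s, deriv (a s) x * iteratedDeriv k (g s) x = 0 := by
    intro k hk
    have h1 : HasDerivAt (fun y => ∑ s, a s y * iteratedDeriv k (g s) y)
        (∑ s, (deriv (a s) x * iteratedDeriv k (g s) x +
          a s x * iteratedDeriv (k + 1) (g s) x)) x := by
      refine HasDerivAt.fun_sum fun s _ => ?_
      refine HasDerivAt.mul ((ha s).differentiableAt (hU.mem_nhds hx)).hasDerivAt ?_
      rw [iteratedDeriv_succ]
      exact (differentiable_iteratedDeriv (hg s) k x).hasDerivAt
    have h2 : HasDerivAt (fun y => ∑ s, a s y * iteratedDeriv k (g s) y)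
        (iteratedDeriv (k + 1) f x) x := by
      rw [iteratedDeriv_succ]
      refine (differentiable_iteratedDeriv hf k x).hasDerivAt.congr_of_eventuallyEq ?_
      filter_upwards [hU.mem_nhds hx] with y hy using hrel y hy k hk.le
    have h3 := h1.unique h2
    rw [Finset.sum_add_distrib, hrel x hx (k + 1) hk] at h3
    simpa using h3
  have hz : (Matrix.of fun k s : Fin m => iteratedDeriv k.val (g s) x).mulVec
      (fun s => deriv (a s) x) = 0 := by
    ext k
    simpa [Matrix.mulVec, dotProduct, mul_comm] using key k k.2
  exact congrFun (Matrix.eq_zero_of_mulVec_eq_zero (hW x hx) hz) s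

/-- Linearly independent entire functions have a Wronskian which is not identically zero. -/
theorem exists_wrDet_ne_zero (m : ℕ) (g : Fin m → ℂ → ℂ) (hg : ∀ i, Differentiable ℂ (g i))
    (hli : LinearIndependent ℂ g) : ∃ x, wrDet m g x ≠ 0 := by
  induction m with
  | zero => exact ⟨0, by simp [wrDet]⟩
  | succ m ih =>
    rw [linearIndependent_finSucc'] at hli
    obtain ⟨hli, hlast⟩ := hli
    obtain ⟨x₀, hx₀⟩ := ih (Fin.init g) (fun i => hg _) hli
    by_contra! hzero
    apply hlast
    set f := g (Fin.last m) with hf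
    have hfd : Differentiable ℂ f := hg _
    set A : ℂ → Matrix (Fin m) (Fin m) ℂ :=
      fun x => Matrix.of fun k s : Fin m => iteratedDeriv k.val (Fin.init g s) x with hA
    set b : ℂ → Fin m → ℂ := fun x k => iteratedDeriv k.val f x with hb
    have hAd : ∀ i j, Differentiable ℂ fun x => A x i j := fun i j =>
      differentiable_iteratedDeriv (hg _) _
    have hbd : ∀ i, Differentiable ℂ fun x => b x i := fun i =>
      differentiable_iteratedDeriv hfd _
    have hdet : ∀ x, wrDet m (Fin.init g) x = (A x).det := fun x => rfl
    have hdetd : Differentiable ℂ fun x => (A x).det := differentiable_det hAd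
    rw [hdet] at hx₀
    obtain ⟨r, hr, hball⟩ := Metric.mem_nhds_iff.1
      ((hdetd.continuous.continuousAt (x := x₀)).eventually_ne hx₀)
    set U := Metric.ball x₀ r with hU
    have hUne : ∀ x ∈ U, (A x).det ≠ 0 := fun x hx => hball hx
    set a : Fin m → ℂ → ℂ := fun s x => (A x).det⁻¹ * (A x).cramer (b x) s with ha
    have had : ∀ s, DifferentiableOn ℂ (a s) U := by
      intro s
      refine DifferentiableOn.mul (hdetd.differentiableOn.inv hUne) ?_
      simp only [Matrix.cramer_apply]
      refine (differentiable_det fun i j => ?_).differentiableOn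
      by_cases h : j = s
      · subst h; simpa using hbd i
      · simpa [Matrix.updateCol_ne h] using hAd i j
    have hAa : ∀ x ∈ U, (A x).mulVec (fun s => a s x) = b x := by
      intro x hx
      have : (fun s => a s x) = (A x).det⁻¹ • (A x).cramer (b x) := by
        ext s; simp [ha]
      rw [this, Matrix.mulVec_smul, Matrix.mulVec_cramer, smul_smul,
        inv_mul_cancel₀ (hUne x hx), one_smul]
    have hrel : ∀ x ∈ U, ∀ k ≤ m,
        ∑ s, a s x * iteratedDeriv k (Fin.init g s) x = iteratedDeriv k f x := by
      intro x hx k hk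
      obtain ⟨v, hv0, hv⟩ := Matrix.exists_mulVec_eq_zero_iff.2 (hzero x)
      have hrow : ∀ k : ℕ, k ≤ m →
          ∑ s, iteratedDeriv k (Fin.init g s) x * v (Fin.castSucc s)
            + iteratedDeriv k f x * v (Fin.last m) = 0 := by
        intro k hk
        have := congrFun hv ⟨k, Nat.lt_succ_of_le hk⟩
        simpa [Matrix.mulVec, dotProduct, Fin.sum_univ_castSucc, Fin.init] using this
      have hvA : (A x).mulVec (fun s => v (Fin.castSucc s)) = - v (Fin.last m) • b x := by
        ext k
        have := hrow k k.2.le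
        simp only [hA, hb, Matrix.mulVec, dotProduct, Matrix.of_apply, Pi.smul_apply, smul_eq_mul]
        linear_combination this
      have hvm : v (Fin.last m) ≠ 0 := by
        intro h0
        rw [h0, neg_zero, zero_smul] at hvA
        have h1 := Matrix.eq_zero_of_mulVec_eq_zero (hUne x hx) hvA
        apply hv0
        ext i
        refine Fin.lastCases h0 (fun j => congrFun h1 j) i
      have hva : (fun s => v (Fin.castSucc s)) = - v (Fin.last m) • fun s => a s x := by
        rw [← sub_eq_zero]
        refine Matrix.eq_zero_of_mulVec_eq_zero (hUne x hx) ?_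
        rw [Matrix.mulVec_sub, hvA, Matrix.mulVec_smul, hAa x hx, sub_self]
      have hs : ∀ s, v (Fin.castSucc s) = - v (Fin.last m) * a s x := fun s => congrFun hva s
      have := hrow k hk
      simp only [hs] at this
      refine mul_left_cancel₀ hvm ?_
      rw [Finset.mul_sum, ← sub_eq_zero, ← neg_eq_zero, ← this, neg_sub, sub_eq_add_neg,
        ← Finset.sum_neg_distrib, add_comm, mul_comm (v _)]
      congr 1
      refine Finset.sum_congr rfl fun s _ => ?_
      ring
    have hconst : ∀ s, ∀ x ∈ U, a s x = a s x₀ := fun s x hx =>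
      Metric.isOpen_ball.is_const_of_deriv_eq_zero (convex_ball x₀ r).isPreconnected (had s)
        (fun y hy => deriv_eq_zero_of_wronskian_relation (g := Fin.init g) (fun i => hg _) hfd
          Metric.isOpen_ball had hUne hrel hy s) hx (Metric.mem_ball_self hr)
    have hfeq : f = ∑ s, a s x₀ • Fin.init g s := by
      have hsum : (∑ s, a s x₀ • Fin.init g s) = fun x => ∑ s, a s x₀ * Fin.init g s x := by
        ext x; simp
      rw [hsum]
      refine AnalyticOnNhd.eq_of_eventuallyEq (𝕜 := ℂ) (z₀ := x₀)
        (hfd.differentiableOn.analyticOnNhd isOpen_univ)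
        (DifferentiableOn.analyticOnNhd (Differentiable.differentiableOn ?_) isOpen_univ) ?_
      · exact Differentiable.fun_sum fun s _ => (hg _).const_mul _
      · filter_upwards [Metric.isOpen_ball.mem_nhds (Metric.mem_ball_self hr)] with x hx
        have := hrel x hx 0 (Nat.zero_le _)
        simp only [iteratedDeriv_zero] at this
        rw [← this]
        exact Finset.sum_congr rfl fun s _ => by rw [hconst s x hx]
    rw [hfeq]
    exact Submodule.sum_mem _ fun s _ =>
      Submodule.smul_mem _ _ (Submodule.subset_span ⟨s, rfl⟩)

/-- The operator `d/dx + a` on polynomials: differentiation of `q(x)·e^{ax}` seen on `q`. -/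
noncomputable def twistedDerivative (a : ℂ) : Module.End ℂ (Polynomial ℂ) :=
  Polynomial.derivative + a • LinearMap.id

theorem twistedDerivative_apply (a : ℂ) (q : Polynomial ℂ) :
    twistedDerivative a q = Polynomial.derivative q + Polynomial.C a * q := by
  simp [twistedDerivative, Polynomial.smul_eq_C_mul]

theorem twistedDerivative_pow_succ (a : ℂ) (k : ℕ) (q : Polynomial ℂ) :
    (twistedDerivative a ^ (k + 1)) q = twistedDerivative a ((twistedDerivative a ^ k) q) := by
  rw [pow_succ', Module.End.mul_apply]

theorem twistedDerivative_pow_succ' (a : ℂ) (k : ℕ) (q : Polynomial ℂ) :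
    (twistedDerivative a ^ (k + 1)) q = (twistedDerivative a ^ k) (twistedDerivative a q) := by
  rw [pow_succ, Module.End.mul_apply]

theorem twistedDerivative_pow_one (a : ℂ) (k : ℕ) :
    (twistedDerivative a ^ k) 1 = Polynomial.C (a ^ k) := by
  induction k with
  | zero => simp
  | succ k ih =>
    rw [twistedDerivative_pow_succ, ih, twistedDerivative_apply, Polynomial.derivative_C, zero_add,
      ← Polynomial.C_mul, pow_succ']

theorem twistedDerivative_mul (a b : ℂ) (q r : Polynomial ℂ) :
    twistedDerivative a (q * r)
      = twistedDerivative b q * r + q * twistedDerivative (a - b) r := by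
  simp only [twistedDerivative_apply, Polynomial.derivative_mul, Polynomial.C_sub]
  ring

theorem hasDerivAt_eval_mul_exp (a : ℂ) (q : Polynomial ℂ) (x : ℂ) :
    HasDerivAt (fun x => q.eval x * Complex.exp (a * x))
      ((twistedDerivative a q).eval x * Complex.exp (a * x)) x := by
  have h := (q.hasDerivAt x).mul (((hasDerivAt_id x).const_mul a).cexp)
  refine h.congr_deriv ?_
  simp [twistedDerivative_apply]
  ring

theorem iteratedDeriv_eval_mul_exp (a : ℂ) (q : Polynomial ℂ) (k : ℕ) :
    iteratedDeriv k (fun x => q.eval x * Complex.exp (a * x))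
      = fun x => ((twistedDerivative a ^ k) q).eval x * Complex.exp (a * x) := by
  induction k with
  | zero => simp
  | succ k ih =>
    rw [iteratedDeriv_succ, ih]
    ext x
    rw [(hasDerivAt_eval_mul_exp a _ x).deriv, twistedDerivative_pow_succ]

theorem differentiable_eval_mul_exp (a : ℂ) (q : Polynomial ℂ) :
    Differentiable ℂ (fun x => q.eval x * Complex.exp (a * x)) :=
  fun x => (hasDerivAt_eval_mul_exp a q x).differentiableAt

theorem differentiable_phiExp (n : ℕ) (p : ℕ → Polynomial ℂ) (lam : ℕ → ℂ) (i : Fin n) :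
    Differentiable ℂ (phiExp n p lam i) :=
  differentiable_eval_mul_exp _ _

/-- The polynomial matrix of `Wr(φ_1, …, φ_n)` with the exponentials removed, with rows chosen
by `r`. -/
noncomputable def reducedWronskian (n : ℕ) (p : ℕ → Polynomial ℂ) (lam : ℕ → ℂ)
    (r : Fin n → ℕ) : Matrix (Fin n) (Fin n) (Polynomial ℂ) :=
  Matrix.of fun k s => (twistedDerivative (lam s.val) ^ r k) (p s.val)

/-- The polynomial coefficients of the operator `K̄`. -/
noncomputable def kbarCoeff (n : ℕ) (p : ℕ → Polynomial ℂ) (lam : ℕ → ℂ) (k : ℕ) :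
    Polynomial ℂ :=
  if h : k < n + 1 then
    (-1) ^ (k + n) *
      (reducedWronskian n p lam fun i => ((⟨k, h⟩ : Fin (n + 1)).succAbove i).val).det
  else 0

theorem kbarOne_eq_sum (n : ℕ) (p : ℕ → Polynomial ℂ) (lam : ℕ → ℂ) (u : ℂ → ℂ) (x : ℂ) :
    kbarOne n p lam u x
      = ∑ k ∈ Finset.range (n + 1), (kbarCoeff n p lam k).eval x * iteratedDeriv k u x := by
  set B : Matrix (Fin (n + 1)) (Fin (n + 1)) ℂ := Matrix.of fun k s =>
    Fin.snoc (α := fun _ => ℂ)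
      (fun s : Fin n => ((twistedDerivative (lam s.val) ^ k.val) (p s.val)).eval x)
      (iteratedDeriv k.val u x) s with hB
  set v : Fin (n + 1) → ℂ :=
    Fin.snoc (α := fun _ => ℂ) (fun s : Fin n => Complex.exp (lam s.val * x)) 1 with hv
  have h1 : wrDetB n (phiExp n p lam) u x = (∏ i, v i) * B.det := by
    rw [← Matrix.det_mul_row, wrDetB, wrDet]
    congr 1
    ext k s
    refine Fin.lastCases ?_ (fun s => ?_) s
    · simp [hB, hv]
    · simp only [hB, hv, Matrix.of_apply, Fin.snoc_castSucc]
      unfold phiExp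
      rw [iteratedDeriv_eval_mul_exp, mul_comm]
  have h2 : Complex.exp (-x * ∑ i ∈ Finset.range n, lam i) * ∏ i, v i = 1 := by
    rw [Fin.prod_univ_castSucc]
    simp only [hv, Fin.snoc_castSucc, Fin.snoc_last, mul_one]
    rw [← Complex.exp_sum, ← Complex.exp_add, Finset.sum_range, ← Finset.sum_mul]
    rw [Complex.exp_eq_one_iff]
    exact ⟨0, by push_cast; ring⟩
  rw [kbarOne, h1, ← mul_assoc, h2, one_mul, Matrix.det_succ_column B (Fin.last n),
    Finset.sum_range]
  refine Finset.sum_congr rfl fun k _ => ?_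
  rw [kbarCoeff, dif_pos k.2, Polynomial.eval_mul]
  have h3 : (B.submatrix k.succAbove (Fin.last n).succAbove).det
      = ((reducedWronskian n p lam fun i => (k.succAbove i).val).det).eval x := by
    rw [← Polynomial.coe_evalRingHom, RingHom.map_det]
    congr 1
    ext i j
    simp [hB, reducedWronskian]
  rw [h3]
  simp [hB]
  ring

theorem kbarCoeff_self (n : ℕ) (p : ℕ → Polynomial ℂ) (lam : ℕ → ℂ) :
    kbarCoeff n p lam n = (reducedWronskian n p lam Fin.val).det := by
  have h : (⟨n, Nat.lt_succ_self n⟩ : Fin (n + 1)) = Fin.last n := rfl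
  rw [kbarCoeff, dif_pos (Nat.lt_succ_self n), h, ← two_mul, pow_mul]
  simp

theorem wrDet_phiExp (n : ℕ) (p : ℕ → Polynomial ℂ) (lam : ℕ → ℂ) (x : ℂ) :
    wrDet n (phiExp n p lam) x
      = (∏ s : Fin n, Complex.exp (lam s.val * x)) * (kbarCoeff n p lam n).eval x := by
  rw [kbarCoeff_self, ← Polynomial.coe_evalRingHom, RingHom.map_det, ← Matrix.det_mul_row, wrDet]
  congr 1
  ext k s
  simp only [Matrix.of_apply, RingHom.mapMatrix_apply, Matrix.map_apply, reducedWronskian]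
  unfold phiExp
  rw [iteratedDeriv_eval_mul_exp, mul_comm]
  rfl

theorem kbarCoeff_self_ne_zero {n : ℕ} {p : ℕ → Polynomial ℂ} {lam : ℕ → ℂ}
    (hind : LinearIndependent ℂ (phiExp n p lam)) : kbarCoeff n p lam n ≠ 0 := by
  obtain ⟨x, hx⟩ := exists_wrDet_ne_zero n _ (differentiable_phiExp n p lam) hind
  intro h
  rw [wrDet_phiExp, h] at hx
  simp at hx

/-- `K̄` annihilates each `φ_i`. -/
theorem sum_kbarCoeff_mul_twistedDerivative (n : ℕ) (p : ℕ → Polynomial ℂ) (lam : ℕ → ℂ)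
    (i : Fin n) :
    ∑ k ∈ Finset.range (n + 1),
      kbarCoeff n p lam k * (twistedDerivative (lam i.val) ^ k) (p i.val) = 0 := by
  refine Polynomial.funext fun x => ?_
  have h0 : kbarOne n p lam (phiExp n p lam i) x = 0 := by
    rw [kbarOne, wrDetB, wrDet,
      Matrix.det_zero_of_column_eq (Fin.castSucc_lt_last i).ne (fun k => by simp), mul_zero]
  rw [kbarOne_eq_sum] at h0
  unfold phiExp at h0
  simp only [iteratedDeriv_eval_mul_exp, ← mul_assoc, ← Finset.sum_mul] at h0
  have := (mul_eq_zero.1 h0).resolve_right (Complex.exp_ne_zero _)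
  simpa [Polynomial.eval_finsetSum] using this

/-- Coefficients of the method of variation of parameters. -/
theorem exists_variation_coeff (n : ℕ) (p : ℕ → Polynomial ℂ) (lam : ℕ → ℂ) :
    ∃ w : Fin n → Polynomial ℂ, ∀ k < n,
      ∑ i : Fin n, (twistedDerivative (lam i.val) ^ k) (p i.val) * w i
        = if k + 1 = n then kbarCoeff n p lam n else 0 := by
  cases n with
  | zero => exact ⟨0, fun k hk => absurd hk (Nat.not_lt_zero k)⟩
  | succ m =>
    refine ⟨fun i => (reducedWronskian (m + 1) p lam Fin.val).adjugate i (Fin.last m),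
      fun k hk => ?_⟩
    have h := congrFun (congrFun (Matrix.mul_adjugate
      (reducedWronskian (m + 1) p lam Fin.val)) ⟨k, hk⟩) (Fin.last m)
    rw [Matrix.mul_apply] at h
    rw [kbarCoeff_self]
    refine Eq.trans h ?_
    simp [Matrix.one_apply, Fin.ext_iff]

/-- A polynomial primitive of `(z - l)^N·w(x)·e^{(z-l)x}`, up to the exponential factor. -/
theorem twistedDerivative_sum (a : ℂ) (w : Polynomial ℂ) (N : ℕ) :
    twistedDerivative a (∑ j ∈ Finset.range N,
        Polynomial.C ((-1) ^ j * a ^ (N - 1 - j)) * Polynomial.derivative^[j] w)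
      = Polynomial.C (a ^ N) * w
        - Polynomial.C ((-1) ^ N) * Polynomial.derivative^[N] w := by
  induction N with
  | zero => simp
  | succ N ih =>
    have h : (∑ j ∈ Finset.range (N + 1),
        Polynomial.C ((-1) ^ j * a ^ (N + 1 - 1 - j)) * Polynomial.derivative^[j] w)
        = Polynomial.C a * (∑ j ∈ Finset.range N,
          Polynomial.C ((-1) ^ j * a ^ (N - 1 - j)) * Polynomial.derivative^[j] w)
          + Polynomial.C ((-1) ^ N) * Polynomial.derivative^[N] w := by
      rw [Finset.sum_range_succ, Finset.mul_sum]
      congr 1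
      · refine Finset.sum_congr rfl fun j hj => ?_
        have : N + 1 - 1 - j = (N - 1 - j) + 1 := by
          have := Finset.mem_range.1 hj
          omega
        rw [this, ← mul_assoc, ← Polynomial.C_mul, pow_succ]
        congr 2
        ring
      · simp
    rw [h, map_add, ← Polynomial.smul_eq_C_mul a, map_smul, ih]
    rw [twistedDerivative_apply, Polynomial.derivative_C_mul, ← Function.iterate_succ_apply'
      (⇑Polynomial.derivative), Polynomial.smul_eq_C_mul]
    simp only [Polynomial.C_pow, Polynomial.C_neg, Polynomial.C_1]
    ring

theorem Polynomial.exists_eval_ne_zero_of_ne_zero {q : Polynomial ℂ} (hq : q ≠ 0) :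
    ∃ x, q.eval x ≠ 0 := by
  by_contra! h
  exact hq (Polynomial.funext fun x => by rw [h x, Polynomial.eval_zero])

/-- The action of `K̄` on `w(x)·e^{xz}`, up to the exponential factor. -/
noncomputable def kbarSymbol (n : ℕ) (p : ℕ → Polynomial ℂ) (lam : ℕ → ℂ) (z : ℂ) :
    Module.End ℂ (Polynomial ℂ) :=
  ∑ k ∈ Finset.range (n + 1),
    LinearMap.mulLeft ℂ (kbarCoeff n p lam k) * twistedDerivative z ^ k

theorem kbarSymbol_apply (n : ℕ) (p : ℕ → Polynomial ℂ) (lam : ℕ → ℂ) (z : ℂ)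
    (w : Polynomial ℂ) :
    kbarSymbol n p lam z w
      = ∑ k ∈ Finset.range (n + 1), kbarCoeff n p lam k * (twistedDerivative z ^ k) w := by
  simp [kbarSymbol, LinearMap.sum_apply]

theorem twistedDerivative_pow_sum {n : ℕ} {lam : ℕ → ℂ} {p : ℕ → Polynomial ℂ} {z δ : ℂ}
    {t : Polynomial ℂ} {g w : Fin n → Polynomial ℂ}
    (hw : ∀ k < n, ∑ i : Fin n, (twistedDerivative (lam i.val) ^ k) (p i.val) * w i
        = if k + 1 = n then t else 0)
    (hg : ∀ i, twistedDerivative (z - lam i.val) (g i) = Polynomial.C δ * w i)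
    (k : ℕ) (hk : k < n) :
    (twistedDerivative z ^ k) (∑ i, p i.val * g i)
      = ∑ i : Fin n, (twistedDerivative (lam i.val) ^ k) (p i.val) * g i ∧
    (twistedDerivative z ^ (k + 1)) (∑ i, p i.val * g i)
      = ∑ i : Fin n, (twistedDerivative (lam i.val) ^ (k + 1)) (p i.val) * g i
        + if k + 1 = n then Polynomial.C δ * t else 0 := by
  have step : ∀ k < n, (twistedDerivative z ^ k) (∑ i, p i.val * g i)
      = ∑ i : Fin n, (twistedDerivative (lam i.val) ^ k) (p i.val) * g i →
      (twistedDerivative z ^ (k + 1)) (∑ i, p i.val * g i)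
      = ∑ i : Fin n, (twistedDerivative (lam i.val) ^ (k + 1)) (p i.val) * g i
        + if k + 1 = n then Polynomial.C δ * t else 0 := by
    intro k hk h
    rw [twistedDerivative_pow_succ, h, map_sum, Finset.sum_congr rfl fun i _ => by
      rw [twistedDerivative_mul z (lam i.val), hg, ← twistedDerivative_pow_succ],
      Finset.sum_add_distrib]
    congr 1
    have h2 := congrArg (fun r => Polynomial.C δ * r) (hw k hk)
    simp only [Finset.mul_sum, mul_ite, mul_zero] at h2
    rw [← h2]
    exact Finset.sum_congr rfl fun i _ => by ring
  induction k with
  | zero =>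
    have h0 : (twistedDerivative z ^ 0) (∑ i, p i.val * g i)
      = ∑ i : Fin n, (twistedDerivative (lam i.val) ^ 0) (p i.val) * g i := by simp
    exact ⟨h0, step 0 hk h0⟩
  | succ k ih =>
    have h1 := (ih (by omega)).2
    rw [if_neg (by omega), add_zero] at h1
    exact ⟨h1, step _ hk h1⟩

/-- Variation of parameters: a solution of `K̄u = δ·τ²·e^{xz}`. -/
theorem kbarSymbol_variation {n : ℕ} (hn : n ≠ 0) {lam : ℕ → ℂ} {p : ℕ → Polynomial ℂ} {z δ : ℂ}
    {g w : Fin n → Polynomial ℂ}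
    (hw : ∀ k < n, ∑ i : Fin n, (twistedDerivative (lam i.val) ^ k) (p i.val) * w i
        = if k + 1 = n then kbarCoeff n p lam n else 0)
    (hg : ∀ i, twistedDerivative (z - lam i.val) (g i) = Polynomial.C δ * w i) :
    kbarSymbol n p lam z (∑ i, p i.val * g i) = Polynomial.C δ * kbarCoeff n p lam n ^ 2 := by
  obtain ⟨m, rfl⟩ := Nat.exists_eq_succ_of_ne_zero hn
  have h := twistedDerivative_pow_sum hw hg
  rw [kbarSymbol_apply, Finset.sum_range_succ, (h m (Nat.lt_succ_self m)).2, if_pos rfl, mul_add,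
    Finset.sum_congr rfl fun k hk => by rw [(h k (Finset.mem_range.1 hk)).1], ← add_assoc,
    ← Finset.sum_range_succ (fun k => kbarCoeff (m + 1) p lam k *
      ∑ i : Fin (m + 1), (twistedDerivative (lam i.val) ^ k) (p i.val) * g i)]
  simp only [Finset.mul_sum]
  rw [Finset.sum_comm]
  simp only [← mul_assoc, ← Finset.sum_mul, sum_kbarCoeff_mul_twistedDerivative]
  simp only [zero_mul, Finset.sum_const_zero]
  ring

/-- Some `f(x)·e^{xz}` with `f ≠ 0` is in the image of `K̄` on polynomials in `x` times `e^{xz}`,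
with coefficients that are rational in `z`. -/
theorem exists_kbarSymbol_eq (n : ℕ) (p : ℕ → Polynomial ℂ) (lam : ℕ → ℂ)
    (hτ : kbarCoeff n p lam n ≠ 0) :
    ∃ (f den : Polynomial ℂ) (ι : Type) (_ : Fintype ι) (r w : ι → Polynomial ℂ),
      f ≠ 0 ∧ den ≠ 0 ∧ ∀ z : ℂ,
        kbarSymbol n p lam z (∑ a, Polynomial.C ((r a).eval z) * w a)
          = Polynomial.C (den.eval z) * f := by
  rcases eq_or_ne n 0 with rfl | hn
  · refine ⟨kbarCoeff 0 p lam 0, 1, Unit, inferInstance, fun _ => 1, fun _ => 1, hτ, one_ne_zero,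
      fun z => ?_⟩
    simp [kbarSymbol_apply]
  obtain ⟨w, hw⟩ := exists_variation_coeff n p lam
  obtain ⟨N, hN⟩ : ∃ N, ∀ i, (w i).natDegree < N :=
    ⟨(Finset.univ.sup fun i => (w i).natDegree) + 1, fun i => Nat.lt_succ_of_le
      (Finset.le_sup (f := fun i => (w i).natDegree) (Finset.mem_univ i))⟩
  set L : Fin n → Polynomial ℂ := fun i => (Polynomial.X - Polynomial.C (lam i.val)) ^ N with hL
  refine ⟨kbarCoeff n p lam n ^ 2, ∏ i, L i, Fin n × Fin N, inferInstance,
    fun a => (∏ i ∈ Finset.univ.erase a.1, L i) *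
      (Polynomial.C ((-1) ^ a.2.val) *
        (Polynomial.X - Polynomial.C (lam a.1.val)) ^ (N - 1 - a.2.val)),
    fun a => p a.1.val * Polynomial.derivative^[a.2.val] (w a.1), pow_ne_zero _ hτ,
    Finset.prod_ne_zero_iff.2 fun i _ => pow_ne_zero _ (Polynomial.X_sub_C_ne_zero _),
    fun z => ?_⟩
  rw [← kbarSymbol_variation hn hw (g := fun i =>
    Polynomial.C ((∏ i ∈ Finset.univ.erase i, L i).eval z) * ∑ j ∈ Finset.range N,
        Polynomial.C ((-1) ^ j * (z - lam i.val) ^ (N - 1 - j)) * Polynomial.derivative^[j] (w i))]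
  · congr 1
    rw [Fintype.sum_prod_type]
    refine Finset.sum_congr rfl fun i _ => ?_
    rw [Finset.sum_range, Finset.mul_sum, Finset.mul_sum]
    refine Finset.sum_congr rfl fun j _ => ?_
    simp only [Polynomial.eval_mul, Polynomial.eval_pow, Polynomial.eval_sub, Polynomial.eval_X,
      Polynomial.eval_C, Polynomial.C_mul]
    ring
  · intro i
    rw [← Polynomial.smul_eq_C_mul, map_smul, twistedDerivative_sum,
      Polynomial.iterate_derivative_eq_zero (hN i), mul_zero, sub_zero, Polynomial.smul_eq_C_mul,
      ← mul_assoc, ← Polynomial.C_mul, ← Finset.prod_erase_mul _ _ (Finset.mem_univ i),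
      Polynomial.eval_mul]
    simp [hL]

/-- `K̄(w(x)·e^{xz})`. -/
noncomputable def kbarExp (n : ℕ) (p : ℕ → Polynomial ℂ) (lam : ℕ → ℂ) (w : Polynomial ℂ)
    (x z : ℂ) : ℂ :=
  (kbarSymbol n p lam z w).eval x * Complex.exp (x * z)

theorem kbarOne_exp (n : ℕ) (p : ℕ → Polynomial ℂ) (lam : ℕ → ℂ) (x z : ℂ) :
    kbarOne n p lam (fun t => Complex.exp (t * z)) x = kbarExp n p lam 1 x z := by
  have h : (fun t => Complex.exp (t * z))
      = fun t => (1 : Polynomial ℂ).eval t * Complex.exp (z * t) := by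
    ext t; simp [mul_comm]
  rw [kbarOne_eq_sum, h, kbarExp, kbarSymbol_apply, Polynomial.eval_finsetSum, Finset.sum_mul]
  refine Finset.sum_congr rfl fun k _ => ?_
  simp only [iteratedDeriv_eval_mul_exp, Polynomial.eval_mul, mul_comm z x, mul_assoc]

theorem kbarExp_one (n : ℕ) (p : ℕ → Polynomial ℂ) (lam : ℕ → ℂ) (x z : ℂ) :
    kbarExp n p lam 1 x z
      = (∑ k ∈ Finset.range (n + 1), (kbarCoeff n p lam k).eval x * z ^ k)
        * Complex.exp (x * z) := by
  simp [kbarExp, kbarSymbol_apply, Polynomial.eval_finsetSum, twistedDerivative_pow_one]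

theorem hasDerivAt_twistedDerivative_pow (k : ℕ) (w : Polynomial ℂ) (x z : ℂ) :
    HasDerivAt (fun z => ((twistedDerivative z ^ k) w).eval x * Complex.exp (x * z))
      (((twistedDerivative z ^ k) (Polynomial.X * w)).eval x * Complex.exp (x * z)) z := by
  induction k generalizing w with
  | zero =>
    have h := (((hasDerivAt_id z).const_mul x).cexp).const_mul (w.eval x)
    simp only [pow_zero, Module.End.one_apply]
    refine h.congr_deriv ?_
    simp
    ring
  | succ k ih =>
    have e : ∀ (z : ℂ) (w : Polynomial ℂ), (twistedDerivative z ^ (k + 1)) w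
        = (twistedDerivative z ^ k) (Polynomial.derivative w)
          + z • (twistedDerivative z ^ k) w := by
      intro z w
      rw [twistedDerivative_pow_succ', twistedDerivative_apply, map_add,
        ← Polynomial.smul_eq_C_mul, map_smul]
    have h := (ih (Polynomial.derivative w)).add ((hasDerivAt_id z).mul (ih w))
    refine (h.congr_of_eventuallyEq (Filter.Eventually.of_forall fun y => ?_)).congr_deriv ?_
    · simp [e]
      ring
    · simp only [e, Polynomial.derivative_mul, Polynomial.derivative_X, one_mul, map_add,
        Polynomial.eval_add, Polynomial.eval_smul, smul_eq_mul, id]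
      ring

theorem hasDerivAt_kbarExp (n : ℕ) (p : ℕ → Polynomial ℂ) (lam : ℕ → ℂ) (w : Polynomial ℂ)
    (x z : ℂ) :
    HasDerivAt (kbarExp n p lam w x) (kbarExp n p lam (Polynomial.X * w) x z) z := by
  have h : ∀ w : Polynomial ℂ, kbarExp n p lam w x = fun z => ∑ k ∈ Finset.range (n + 1),
      (kbarCoeff n p lam k).eval x *
        (((twistedDerivative z ^ k) w).eval x * Complex.exp (x * z)) := by
    intro w
    ext z
    rw [kbarExp, kbarSymbol_apply, Polynomial.eval_finsetSum, Finset.sum_mul]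
    simp only [Polynomial.eval_mul, mul_assoc]
  rw [h, h]
  exact HasDerivAt.fun_sum fun k _ => (hasDerivAt_twistedDerivative_pow k w x z).const_mul _

theorem iteratedDeriv_kbarExp (n : ℕ) (p : ℕ → Polynomial ℂ) (lam : ℕ → ℂ) (x : ℂ) (j : ℕ) :
    iteratedDeriv j (kbarExp n p lam 1 x) = kbarExp n p lam (Polynomial.X ^ j) x := by
  induction j with
  | zero => simp
  | succ j ih =>
    rw [iteratedDeriv_succ, ih]
    ext z
    rw [(hasDerivAt_kbarExp n p lam _ x z).deriv, pow_succ']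

/-- The functions obtained from `ψ` by differential operators in `z` with polynomial
coefficients. -/
noncomputable def waveModule (n : ℕ) (p : ℕ → Polynomial ℂ) (lam : ℕ → ℂ) :
    Submodule ℂ (ℂ → ℂ → ℂ) :=
  Submodule.span ℂ (Set.range fun a : ℕ × ℕ => fun x z : ℂ =>
    z ^ a.1 * kbarExp n p lam (Polynomial.X ^ a.2) x z)

section waveModule

variable {n : ℕ} {p : ℕ → Polynomial ℂ} {lam : ℕ → ℂ} {G : ℂ → ℂ → ℂ}

theorem pow_mul_mem_waveModule (hG : G ∈ waveModule n p lam) (k : ℕ) :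
    (fun x z => z ^ k * G x z) ∈ waveModule n p lam := by
  unfold waveModule at hG
  induction hG using Submodule.span_induction with
  | mem G h =>
    obtain ⟨a, rfl⟩ := h
    refine Submodule.subset_span ⟨(k + a.1, a.2), ?_⟩
    ext x z
    simp only
    ring
  | zero =>
    convert (waveModule n p lam).zero_mem using 1
    ext; simp
  | add F G _ _ hF hG =>
    convert (waveModule n p lam).add_mem hF hG using 1
    ext x z; simp; ring
  | smul c G _ hG =>
    convert (waveModule n p lam).smul_mem c hG using 1
    ext x z; simp; ring

theorem eval_mul_mem_waveModule (hG : G ∈ waveModule n p lam) (q : Polynomial ℂ) :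
    (fun x z => q.eval z * G x z) ∈ waveModule n p lam := by
  have h : (fun x z => q.eval z * G x z)
      = ∑ k ∈ Finset.range (q.natDegree + 1), q.coeff k • fun x z => z ^ k * G x z := by
    ext x z
    simp [Polynomial.eval_eq_sum_range, Finset.sum_mul, mul_assoc]
  rw [h]
  exact Submodule.sum_mem _ fun k _ => Submodule.smul_mem _ _ (pow_mul_mem_waveModule hG k)

theorem kbarExp_mem_waveModule (w : Polynomial ℂ) : kbarExp n p lam w ∈ waveModule n p lam := by
  have h : kbarExp n p lam w = ∑ k ∈ Finset.range (w.natDegree + 1),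
      w.coeff k • kbarExp n p lam (Polynomial.X ^ k) := by
    ext x z
    have hw : w = ∑ k ∈ Finset.range (w.natDegree + 1), w.coeff k • Polynomial.X ^ k := by
      conv_lhs => rw [w.as_sum_range_C_mul_X_pow]
      simp [Polynomial.smul_eq_C_mul]
    conv_lhs => rw [kbarExp, hw, map_sum, Polynomial.eval_finsetSum, Finset.sum_mul]
    simp [kbarExp, mul_assoc]
  rw [h]
  refine Submodule.sum_mem _ fun k _ => Submodule.smul_mem _ _ (Submodule.subset_span ⟨(0, k), ?_⟩)
  ext x z
  simp

theorem exists_hasDerivAt_mem_waveModule (hG : G ∈ waveModule n p lam) :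
    ∃ G' ∈ waveModule n p lam, ∀ x z, HasDerivAt (G x) (G' x z) z := by
  unfold waveModule at hG
  induction hG using Submodule.span_induction with
  | mem G h =>
    obtain ⟨⟨i, j⟩, rfl⟩ := h
    refine ⟨fun x z => (i * z ^ (i - 1)) * kbarExp n p lam (Polynomial.X ^ j) x z
      + z ^ i * kbarExp n p lam (Polynomial.X * Polynomial.X ^ j) x z, ?_, fun x z =>
        (hasDerivAt_pow i z).mul (hasDerivAt_kbarExp n p lam _ x z)⟩
    refine Submodule.add_mem _ ?_ (pow_mul_mem_waveModule (kbarExp_mem_waveModule _) i)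
    convert (waveModule n p lam).smul_mem (i : ℂ)
      (pow_mul_mem_waveModule (kbarExp_mem_waveModule (Polynomial.X ^ j)) (i - 1)) using 1
    ext x z
    simp [mul_assoc]
  | zero => exact ⟨0, Submodule.zero_mem _, fun x z => hasDerivAt_const z 0⟩
  | add F G _ _ hF hG =>
    obtain ⟨F', hF', hF⟩ := hF
    obtain ⟨G', hG', hG⟩ := hG
    exact ⟨F' + G', Submodule.add_mem _ hF' hG', fun x z => (hF x z).add (hG x z)⟩
  | smul c G _ hG =>
    obtain ⟨G', hG', hG⟩ := hG
    exact ⟨c • G', Submodule.smul_mem _ c hG', fun x z => (hG x z).const_smul c⟩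

theorem exists_finsupp_of_mem_waveModule (hG : G ∈ waveModule n p lam) :
    ∃ C : ℕ →₀ Polynomial ℂ, ∀ x z, G x z
      = C.sum fun k q => q.eval z * kbarExp n p lam (Polynomial.X ^ k) x z := by
  unfold waveModule at hG
  induction hG using Submodule.span_induction with
  | mem G h =>
    obtain ⟨⟨i, j⟩, rfl⟩ := h
    exact ⟨Finsupp.single j (Polynomial.X ^ i), fun x z => by
      rw [Finsupp.sum_single_index (by simp)]; simp⟩
  | zero => exact ⟨0, fun x z => by simp⟩
  | add F G _ _ hF hG =>
    obtain ⟨B, hB⟩ := hF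
    obtain ⟨C, hC⟩ := hG
    refine ⟨B + C, fun x z => ?_⟩
    rw [Finsupp.sum_add_index' (by simp) (by intros; simp; ring), ← hB, ← hC]
    rfl
  | smul c G _ hG =>
    obtain ⟨C, hC⟩ := hG
    refine ⟨c • C, fun x z => ?_⟩
    rw [Finsupp.sum_smul_index' (by simp)]
    simp [hC, Finsupp.sum, Finset.mul_sum, mul_assoc]

/-- If `den(z)·f(x)·e^{xz}` is obtained from `ψ`, then so are the `f(x)·xˡ·e^{xz}`, up to powers of
`den`. -/
theorem pow_mul_exp_mem_waveModule {f : ℂ → ℂ} {den : Polynomial ℂ}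
    (h : (fun x z => den.eval z * (f x * Complex.exp (x * z))) ∈ waveModule n p lam) (l : ℕ) :
    (fun x z => den.eval z ^ (l + 1) * (f x * x ^ l * Complex.exp (x * z)))
      ∈ waveModule n p lam := by
  induction l with
  | zero => simpa using h
  | succ l ih =>
    obtain ⟨G', hG', hG⟩ := exists_hasDerivAt_mem_waveModule ih
    convert Submodule.sub_mem _ (eval_mul_mem_waveModule hG' den)
      (eval_mul_mem_waveModule ih (Polynomial.C ((l : ℂ) + 1) * Polynomial.derivative den)) using 1
    ext x z
    have h1 := ((den.hasDerivAt z).pow (l + 1)).mul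
      ((((hasDerivAt_id z).const_mul x).cexp).const_mul (f x * x ^ l))
    have h2 := (hG x z).unique h1
    simp only [Pi.sub_apply, h2]
    simp
    ring

theorem pow_mul_eval_mul_exp_mem_waveModule {f : ℂ → ℂ} {den : Polynomial ℂ}
    (h : (fun x z => den.eval z * (f x * Complex.exp (x * z))) ∈ waveModule n p lam)
    (w : Polynomial ℂ) {m : ℕ} (hm : w.natDegree ≤ m) :
    (fun x z => den.eval z ^ (m + 1) * (f x * w.eval x * Complex.exp (x * z)))
      ∈ waveModule n p lam := by
  have e : (fun x z => den.eval z ^ (m + 1) * (f x * w.eval x * Complex.exp (x * z)))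
      = ∑ l ∈ Finset.range (w.natDegree + 1), w.coeff l • fun x z => (den ^ (m - l)).eval z *
        (den.eval z ^ (l + 1) * (f x * x ^ l * Complex.exp (x * z))) := by
    ext x z
    simp only [Finset.sum_apply, Pi.smul_apply, smul_eq_mul, Polynomial.eval_eq_sum_range (p := w),
      Finset.mul_sum, Finset.sum_mul]
    refine Finset.sum_congr rfl fun l hl => ?_
    have : m + 1 = (m - l) + (l + 1) := by
      have := Finset.mem_range.1 hl
      omega
    rw [this, pow_add, Polynomial.eval_pow]
    ring
  rw [e]
  exact Submodule.sum_mem _ fun l _ => Submodule.smul_mem _ _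
    (eval_mul_mem_waveModule (pow_mul_exp_mem_waveModule h l) _)

end waveModule

theorem exists_mul_kbarExp_mem_waveModule {n : ℕ} {p : ℕ → Polynomial ℂ} {lam : ℕ → ℂ}
    (hτ : kbarCoeff n p lam n ≠ 0) :
    ∃ s den : Polynomial ℂ, 0 < s.degree ∧ den ≠ 0 ∧
      (fun x z => den.eval z * (s.eval x * kbarExp n p lam 1 x z)) ∈ waveModule n p lam := by
  obtain ⟨f, den, ι, _, r, w, hf, hden, hrw⟩ := exists_kbarSymbol_eq n p lam hτ
  have h0 : (fun x z => den.eval z * (f.eval x * Complex.exp (x * z))) ∈ waveModule n p lam := by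
    have e : (fun x z => den.eval z * (f.eval x * Complex.exp (x * z)))
        = ∑ a, fun x z => (r a).eval z * kbarExp n p lam (w a) x z := by
      ext x z
      have := congrArg (fun q => q.eval x * Complex.exp (x * z)) (hrw z)
      simp only [map_sum, ← Polynomial.smul_eq_C_mul,
        map_smul, Polynomial.eval_finsetSum, Polynomial.eval_smul, smul_eq_mul,
        Finset.sum_mul] at this
      simp only [Finset.sum_apply, kbarExp]
      rw [← mul_assoc, ← this]
      exact Finset.sum_congr rfl fun a _ => by ring
    rw [e]
    exact Submodule.sum_mem _ fun a _ => eval_mul_mem_waveModule (kbarExp_mem_waveModule _) _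
  set m := (Finset.range (n + 1)).sup fun k =>
    (Polynomial.X * kbarCoeff n p lam k).natDegree with hm
  refine ⟨f * Polynomial.X, den ^ (m + 1), ?_, pow_ne_zero _ hden, ?_⟩
  · rw [← Polynomial.natDegree_pos_iff_degree_pos, Polynomial.natDegree_mul_X hf]
    exact Nat.succ_pos _
  · have e : (fun x z => (den ^ (m + 1)).eval z *
          ((f * Polynomial.X).eval x * kbarExp n p lam 1 x z))
        = ∑ k ∈ Finset.range (n + 1), fun x z => z ^ k * (den.eval z ^ (m + 1) *
          (f.eval x * (Polynomial.X * kbarCoeff n p lam k).eval x * Complex.exp (x * z))) := by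
      ext x z
      simp only [kbarExp_one, Finset.sum_apply, Finset.mul_sum, Finset.sum_mul]
      refine Finset.sum_congr rfl fun k _ => ?_
      simp
      ring
    rw [e]
    exact Submodule.sum_mem _ fun k hk => pow_mul_mem_waveModule
      (pow_mul_eval_mul_exp_mem_waveModule h0 _
        (Finset.le_sup (f := fun k => (Polynomial.X * kbarCoeff n p lam k).natDegree) hk)) k

theorem RatFunc.eval_mul_of_eq_div {r : RatFunc ℂ} {a b : Polynomial ℂ} (hb : b ≠ 0)
    (hr : r = algebraMap (Polynomial ℂ) (RatFunc ℂ) a / algebraMap (Polynomial ℂ) (RatFunc ℂ) b)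
    {z : ℂ} (hz : r.denom.eval z ≠ 0) :
    r.eval (RingHom.id ℂ) z * b.eval z = a.eval z := by
  have h := congrArg (Polynomial.eval z) ((RatFunc.num_mul_eq_mul_denom_iff hb).2 hr)
  rw [Polynomial.eval_mul, Polynomial.eval_mul] at h
  rw [RatFunc.eval, Polynomial.eval₂_id, Polynomial.eval₂_id]
  field_simp
  rw [h, mul_comm]

theorem RatFunc.continuousAt_eval {r : RatFunc ℂ} {z : ℂ} (hz : r.denom.eval z ≠ 0) :
    ContinuousAt (fun z => r.eval (RingHom.id ℂ) z) z := by
  simp only [RatFunc.eval, Polynomial.eval₂_id]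
  exact r.num.continuous.continuousAt.div r.denom.continuous.continuousAt hz

theorem Polynomial.eventually_eval_ne_zero {q : Polynomial ℂ} (hq : q ≠ 0) (z : ℂ) :
    ∀ᶠ w in nhdsWithin z {z}ᶜ, q.eval w ≠ 0 := by
  have hfin : ({w | q.IsRoot w} \ {z}).Finite := (Polynomial.finite_setOfPred_isRoot hq).sdiff
  have h := hfin.isClosed.isOpen_compl.mem_nhds (x := z) (by simp)
  filter_upwards [mem_nhdsWithin_of_mem_nhds h, self_mem_nhdsWithin] with w hw hwz h0
  exact hw ⟨h0, hwz⟩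

/-- An eigenvalue equation `den(z)·s(x)·ψ = ∑ C_k(z) ∂_z^k ψ` with `s` nonconstant has positive
order. -/
theorem exists_pos_mem_support {n : ℕ} {p : ℕ → Polynomial ℂ} {lam : ℕ → ℂ}
    (hτ : kbarCoeff n p lam n ≠ 0) {s den : Polynomial ℂ} (hs : 0 < s.degree) (hden : den ≠ 0)
    {C : ℕ →₀ Polynomial ℂ} (hC : ∀ x z, den.eval z * (s.eval x * kbarExp n p lam 1 x z)
      = C.sum fun k q => q.eval z * kbarExp n p lam (Polynomial.X ^ k) x z) :
    ∃ k ∈ C.support, 1 ≤ k := by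
  by_contra! h
  have hC0 : ∀ x z, den.eval z * (s.eval x * kbarExp n p lam 1 x z)
      = (C 0).eval z * kbarExp n p lam 1 x z := by
    intro x z
    rw [hC, Finsupp.sum_of_support_subset C (s := {0})
      (fun k hk => by simpa using h k hk) _ (by simp)]
    simp
  set Q : ℂ → Polynomial ℂ := fun x => ∑ k ∈ Finset.range (n + 1),
    Polynomial.C ((kbarCoeff n p lam k).eval x) * Polynomial.X ^ k with hQ
  have hQne : ∀ x, (kbarCoeff n p lam n).eval x ≠ 0 → Q x ≠ 0 := by
    intro x hx h0
    apply hx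
    have := congrArg (fun q => q.coeff n) h0
    simpa [hQ, Polynomial.finsetSum_coeff, Polynomial.coeff_C_mul, Polynomial.coeff_X_pow]
      using this
  obtain ⟨x₁, hx₁⟩ := Polynomial.exists_eval_ne_zero_of_ne_zero hτ
  have hs1 : s - Polynomial.C (s.eval x₁) ≠ 0 := by
    intro h0
    rw [sub_eq_zero.1 h0] at hs
    exact absurd Polynomial.degree_C_le (not_le.2 hs)
  obtain ⟨x₂, hx₂⟩ := Polynomial.exists_eval_ne_zero_of_ne_zero (mul_ne_zero hτ hs1)
  rw [Polynomial.eval_mul] at hx₂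
  obtain ⟨z, hz⟩ := Polynomial.exists_eval_ne_zero_of_ne_zero
    (mul_ne_zero (mul_ne_zero hden (hQne x₁ hx₁)) (hQne x₂ (left_ne_zero_of_mul hx₂)))
  rw [Polynomial.eval_mul, Polynomial.eval_mul] at hz
  have hψ : ∀ x, (Q x).eval z ≠ 0 → den.eval z * s.eval x = (C 0).eval z := by
    intro x hx
    refine mul_right_cancel₀ (b := kbarExp n p lam 1 x z) ?_ (by rw [mul_assoc]; exact hC0 x z)
    rw [kbarExp_one]
    refine mul_ne_zero ?_ (Complex.exp_ne_zero _)
    simpa [hQ, Polynomial.eval_finsetSum] using hx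
  have h12 := (hψ x₁ (right_ne_zero_of_mul (left_ne_zero_of_mul hz))).trans
    (hψ x₂ (right_ne_zero_of_mul hz)).symm
  apply right_ne_zero_of_mul hx₂
  rw [Polynomial.eval_sub, Polynomial.eval_C,
    ← mul_left_cancel₀ (left_ne_zero_of_mul (left_ne_zero_of_mul hz)) h12, sub_self]

/-- The constant coefficient operator `q(d/dx)` kills `p(x)·e^{ax}` when `(X - a)^(deg p + 1)`
divides `q`. -/
theorem sum_coeff_mul_iteratedDeriv_eq_zero {a : ℂ} {p q : Polynomial ℂ}
    (h : (Polynomial.X - Polynomial.C a) ^ (p.natDegree + 1) ∣ q) (x : ℂ) :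
    ∑ k ∈ Finset.range (q.natDegree + 1),
      q.coeff k * iteratedDeriv k (fun x => p.eval x * Complex.exp (a * x)) x = 0 := by
  have h1 : Polynomial.aeval (twistedDerivative a) q p = 0 := by
    obtain ⟨r, rfl⟩ := h
    have h2 : twistedDerivative a - algebraMap ℂ (Module.End ℂ (Polynomial ℂ)) a
        = Polynomial.derivative := by
      ext1
      simp [twistedDerivative, Module.algebraMap_end_eq_smul_id]
    rw [mul_comm, map_mul, map_pow, map_sub, Polynomial.aeval_X, Polynomial.aeval_C, h2,
      Module.End.mul_apply, Module.End.pow_apply,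
      Polynomial.iterate_derivative_eq_zero (Nat.lt_succ_self _), map_zero]
  rw [Polynomial.aeval_eq_sum_range] at h1
  have h3 := congrArg (fun r => r.eval x * Complex.exp (a * x)) h1
  simp only [LinearMap.sum_apply, LinearMap.smul_apply, Polynomial.eval_finsetSum,
    Polynomial.eval_smul, smul_eq_mul, Finset.sum_mul, Polynomial.eval_zero, zero_mul] at h3
  simp only [iteratedDeriv_eval_mul_exp, ← mul_assoc]
  exact h3

theorem exists_polynomial_annihilating_span (n : ℕ) (lam : ℕ → ℂ) (p : ℕ → Polynomial ℂ) :
    ∃ q : Polynomial ℂ, 0 < q.degree ∧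
      ∀ v ∈ Submodule.span ℂ (Set.range (phiExp n p lam)), ∀ x,
        ∑ k ∈ Finset.range (q.natDegree + 1), q.coeff k * iteratedDeriv k v x = 0 := by
  set L : ℕ → Polynomial ℂ :=
    fun i => (Polynomial.X - Polynomial.C (lam i)) ^ ((p i).natDegree + 1) with hL
  refine ⟨(∏ i ∈ Finset.range n, L i) * Polynomial.X, ?_, fun v hv => ?_⟩
  · rw [← Polynomial.natDegree_pos_iff_degree_pos, Polynomial.natDegree_mul_X
      (Finset.prod_ne_zero_iff.2 fun i _ => pow_ne_zero _ (Polynomial.X_sub_C_ne_zero _))]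
    exact Nat.succ_pos _
  set q := (∏ i ∈ Finset.range n, L i) * Polynomial.X with hq
  suffices h : Differentiable ℂ v ∧ ∀ x,
      ∑ k ∈ Finset.range (q.natDegree + 1), q.coeff k * iteratedDeriv k v x = 0 from h.2
  induction hv using Submodule.span_induction with
  | mem v h =>
    obtain ⟨i, rfl⟩ := h
    refine ⟨differentiable_phiExp n p lam i, sum_coeff_mul_iteratedDeriv_eq_zero ?_⟩
    exact (Finset.dvd_prod_of_mem L (Finset.mem_range.2 i.2)).mul_right _
  | zero => exact ⟨differentiable_const 0, fun x => by
      simp [show (0 : ℂ → ℂ) = fun _ => 0 from rfl]⟩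
  | add f g _ _ hf hg =>
    refine ⟨hf.1.add hg.1, fun x => ?_⟩
    simp only [iteratedDeriv_add hf.1.contDiff.contDiffAt hg.1.contDiff.contDiffAt, mul_add,
      Finset.sum_add_distrib, hf.2, hg.2, add_zero]
  | smul c f _ hf =>
    refine ⟨hf.1.const_smul c, fun x => ?_⟩
    simp only [iteratedDeriv_const_smul hf.1.contDiff.contDiffAt, smul_eq_mul,
      mul_left_comm _ c, ← Finset.mul_sum, hf.2, mul_zero]

theorem statement19 (n : ℕ) (lam : ℕ → ℂ) (p : ℕ → Polynomial ℂ)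
    (hp : ∀ i < n, p i ≠ 0)
    (hind : LinearIndependent ℂ (phiExp n p lam)) :
    (∃ c : ℕ → Polynomial ℂ, ∀ u : ℂ → ℂ, Differentiable ℂ u → ∀ x : ℂ,
        kbarOne n p lam u x
          = ∑ k ∈ Finset.range (n + 1), (c k).eval x * iteratedDeriv k u x) ∧
    (∃ q : Polynomial ℂ, 0 < q.degree ∧
      ∀ v ∈ Submodule.span ℂ (Set.range (phiExp n p lam)),
        (fun x => ∑ k ∈ Finset.range (q.natDegree + 1), q.coeff k * iteratedDeriv k v x)
          ∈ Submodule.span ℂ (Set.range (phiExp n p lam))) ∧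
    (∃ s : Polynomial ℂ, 0 < s.degree ∧ ∃ d : ℕ, 1 ≤ d ∧
      ∃ c : ℕ → RatFunc ℂ, c d ≠ 0 ∧
        ∀ x z : ℂ, (∀ k ≤ d, Polynomial.eval z (c k).denom ≠ 0) →
          ∑ k ∈ Finset.range (d + 1),
              RatFunc.eval (RingHom.id ℂ) z (c k) *
                iteratedDeriv k (fun w => kbarOne n p lam (fun t => Complex.exp (t * w)) x) z
            = s.eval x * kbarOne n p lam (fun t => Complex.exp (t * z)) x) := by
  refine ⟨⟨kbarCoeff n p lam, fun u _ x => kbarOne_eq_sum n p lam u x⟩, ?_, ?_⟩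
  · obtain ⟨q, hq, h⟩ := exists_polynomial_annihilating_span n lam p
    refine ⟨q, hq, fun v hv => ?_⟩
    rw [funext (h v hv)]
    exact Submodule.zero_mem _
  have hτ := kbarCoeff_self_ne_zero hind
  obtain ⟨s, den, hs, hden, hmem⟩ := exists_mul_kbarExp_mem_waveModule hτ
  obtain ⟨C, hC⟩ := exists_finsupp_of_mem_waveModule hmem
  obtain ⟨k₁, hk₁, hk₁pos⟩ := exists_pos_mem_support hτ hs hden hC
  obtain ⟨d, hd, hmax⟩ := C.support.exists_max_image id ⟨k₁, hk₁⟩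
  have hdenF : algebraMap (Polynomial ℂ) (RatFunc ℂ) den ≠ 0 :=
    (map_ne_zero_iff _ (RatFunc.algebraMap_injective ℂ)).2 hden
  refine ⟨s, hs, d, hk₁pos.trans (hmax k₁ hk₁), fun k =>
    algebraMap (Polynomial ℂ) (RatFunc ℂ) (C k) / algebraMap (Polynomial ℂ) (RatFunc ℂ) den,
    div_ne_zero ((map_ne_zero_iff _ (RatFunc.algebraMap_injective ℂ)).2
      (Finsupp.mem_support_iff.1 hd)) hdenF, fun x z hz => ?_⟩
  set c : ℕ → RatFunc ℂ := fun k =>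
    algebraMap (Polynomial ℂ) (RatFunc ℂ) (C k) / algebraMap (Polynomial ℂ) (RatFunc ℂ) den with hc
  have hz' : ∀ k ∈ Finset.range (d + 1), (c k).denom.eval z ≠ 0 := fun k hk =>
    hz k (Nat.lt_succ_iff.1 (Finset.mem_range.1 hk))
  simp only [kbarOne_exp]
  rw [show (fun w => kbarExp n p lam 1 x w) = kbarExp n p lam 1 x from rfl]
  simp only [iteratedDeriv_kbarExp]
  have hcont : ∀ w : Polynomial ℂ, Continuous (kbarExp n p lam w x) := fun w =>
    continuous_iff_continuousAt.2 fun z => (hasDerivAt_kbarExp n p lam w x z).continuousAt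
  set H : ℂ → ℂ := fun z => ∑ k ∈ Finset.range (d + 1),
    (c k).eval (RingHom.id ℂ) z * kbarExp n p lam (Polynomial.X ^ k) x z
      - s.eval x * kbarExp n p lam 1 x z with hH
  have hHcont : ContinuousAt H z := by
    refine ContinuousAt.sub (tendsto_finsetSum _ fun k hk => ?_)
      ((hcont 1).continuousAt.const_mul _)
    exact (RatFunc.continuousAt_eval (hz' k hk)).mul (hcont _).continuousAt
  have hHzero : ∀ᶠ y in nhdsWithin z {z}ᶜ, H y = 0 := by
    have hev : ∀ᶠ y in nhdsWithin z {z}ᶜ, ∀ k ∈ Finset.range (d + 1), (c k).denom.eval y ≠ 0 :=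
      (Filter.eventually_all_finset _).2 fun k _ =>
        Polynomial.eventually_eval_ne_zero (RatFunc.denom_ne_zero _) z
    filter_upwards [hev, Polynomial.eventually_eval_ne_zero hden z] with y hy hdy
    refine mul_left_cancel₀ hdy ?_
    have h1 := hC x y
    rw [Finsupp.sum_of_support_subset C (s := Finset.range (d + 1))
      (fun k hk => Finset.mem_range.2 (Nat.lt_succ_of_le (hmax k hk))) _ (by simp)] at h1
    rw [hH, mul_sub, h1, Finset.mul_sum, mul_zero, sub_eq_zero]
    refine Finset.sum_congr rfl fun k hk => ?_
    rw [← RatFunc.eval_mul_of_eq_div (r := c k) hden rfl (hy k hk)]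
    ring
  have hlim := tendsto_nhds_unique (hHcont.tendsto.mono_left nhdsWithin_le_nhds)
    (tendsto_const_nhds.congr' (hHzero.mono fun y hy => hy.symm))
  exact sub_eq_zero.1 hlim
end
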